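/- arXiv:2003.00815 — 2 statements merged into one kernel-verified Lean document; each statement's English description precedes it below -/
import Mathlib

section
/- Weil's decomposition (uniqueness of the exponent): If γ·diag(θ^r,1)·z·κ = γ′·diag(θ^{r′},1)·z′·κ′ with r, r′ non-negative integers, γ, γ′ ∈ GL₂(A), z, z′ ∈ K_∞^×, and κ, κ′ ∈ GL₂(O_∞), then r = r′. -/
open Polynomial Matrix

noncomputable section

namespace SturmFF

variable (Fq : Type) [Field Fq] [Fintype Fq]

/-- The local field `K_∞ = 𝔽_q((π_∞))`. -/
abbrev Kinf := LaurentSeries Fq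

/-- The uniformizer `π_∞`. -/
def piInf : Kinf Fq := HahnSeries.single 1 1

/-- The element `θ = π_∞⁻¹` of `K_∞`. -/
def thetaK : Kinf Fq := HahnSeries.single (-1) 1

/-- The embedding `A = 𝔽_q[θ] → K_∞` sending `θ` to `π_∞⁻¹`. -/
def polyToK : Polynomial Fq →+* Kinf Fq := (Polynomial.aeval (thetaK Fq)).toRingHom

/-- Membership in the valuation ring `O_∞ = 𝔽_q[[π_∞]]`. -/
def memO (x : Kinf Fq) : Prop := ∀ n : ℤ, n < 0 → x.coeff n = 0

/-- A matrix has all entries in `O_∞`. -/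
def MatO (κ : Matrix (Fin 2) (Fin 2) (Kinf Fq)) : Prop := ∀ i j, memO Fq (κ i j)

/-- Membership in `GL₂(O_∞)`: entries in `O_∞` and determinant a unit of `O_∞`. -/
def InGLO (κ : Matrix (Fin 2) (Fin 2) (Kinf Fq)) : Prop :=
  MatO Fq κ ∧ κ.det.coeff 0 ≠ 0

/-- Membership in the Iwahori subgroup `I_∞ ⊆ GL₂(O_∞)`. -/
def InIw (κ : Matrix (Fin 2) (Fin 2) (Kinf Fq)) : Prop :=
  InGLO Fq κ ∧ ∀ n : ℤ, n < 1 → (κ 1 0).coeff n = 0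

/-- The matrix `diag(θ^r, 1)`. -/
def Dmat (r : ℕ) : Matrix (Fin 2) (Fin 2) (Kinf Fq) := !![thetaK Fq ^ r, 0; 0, 1]

/-- The matrix `(0, 1; π_∞, 0)`. -/
def Jmat : Matrix (Fin 2) (Fin 2) (Kinf Fq) := !![0, 1; piInf Fq, 0]

/-- The Atkin–Lehner/Fricke matrix `w_𝔫 = (0, -1; 𝔫, 0)`. -/
def wmat (𝔫 : Polynomial Fq) : Matrix (Fin 2) (Fin 2) (Kinf Fq) :=
  !![0, -1; polyToK Fq 𝔫, 0]

/-- Membership in the Hecke congruence subgroup `Γ₀(𝔫) ⊆ GL₂(A)`. -/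
def InGamma0 (𝔫 : Polynomial Fq) (γ : Matrix (Fin 2) (Fin 2) (Polynomial Fq)) : Prop :=
  IsUnit γ.det ∧ 𝔫 ∣ γ 1 0

/-- A `Γ₀(𝔫)`-invariant harmonic cochain, viewed as a function on `GL₂(K_∞)`
(encoded as a function on all matrices, with the conditions imposed on invertible ones). -/
def Harmonic (𝔫 : Polynomial Fq) (f : Matrix (Fin 2) (Fin 2) (Kinf Fq) → ℂ) : Prop :=
  (∀ g : Matrix (Fin 2) (Fin 2) (Kinf Fq), g.det ≠ 0 →
    ∀ γ : Matrix (Fin 2) (Fin 2) (Polynomial Fq), InGamma0 Fq 𝔫 γ →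
    ∀ z : Kinf Fq, z ≠ 0 → ∀ κ : Matrix (Fin 2) (Fin 2) (Kinf Fq), InIw Fq κ →
      f (γ.map (polyToK Fq) * g * (z • (1 : Matrix (Fin 2) (Fin 2) (Kinf Fq))) * κ) = f g)
  ∧ (∀ g : Matrix (Fin 2) (Fin 2) (Kinf Fq), g.det ≠ 0 → f (g * Jmat Fq) = - f g)
  ∧ (∀ g : Matrix (Fin 2) (Fin 2) (Kinf Fq), g.det ≠ 0 →
      (∑ ε : Fq, f (g * !![1, 0; polyToK Fq (Polynomial.C ε), 1])) + f (g * !![0, 1; 1, 0]) = 0)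

/-- A harmonic cochain is cuspidal if it is finitely supported modulo
`Γ₀(𝔫)` on the left and `K_∞^× I_∞` on the right. -/
def Cuspidal (𝔫 : Polynomial Fq) (f : Matrix (Fin 2) (Fin 2) (Kinf Fq) → ℂ) : Prop :=
  ∃ S : Finset (Matrix (Fin 2) (Fin 2) (Kinf Fq)),
    ∀ g : Matrix (Fin 2) (Fin 2) (Kinf Fq), g.det ≠ 0 → f g ≠ 0 →
      ∃ s ∈ S, ∃ γ : Matrix (Fin 2) (Fin 2) (Polynomial Fq), InGamma0 Fq 𝔫 γ ∧
        ∃ z : Kinf Fq, z ≠ 0 ∧ ∃ κ : Matrix (Fin 2) (Fin 2) (Kinf Fq), InIw Fq κ ∧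
          g = γ.map (polyToK Fq) * s * (z • (1 : Matrix (Fin 2) (Fin 2) (Kinf Fq))) * κ

/-- The additive character `ψ` of `K_∞`. -/
def psi (x : Kinf Fq) : ℂ :=
  letI := ZMod.algebra Fq (ringChar Fq)
  Complex.exp (2 * Real.pi * Complex.I *
    ((Algebra.trace (ZMod (ringChar Fq)) Fq (x.coeff 1)).val : ℂ) / (ringChar Fq : ℂ))

/-- The constant Fourier coefficient `c₀(f)`. -/
def c0 (f : Matrix (Fin 2) (Fin 2) (Kinf Fq) → ℂ) : ℂ :=
  (Fintype.card Fq : ℂ)⁻¹ *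
    ∑ c : Fq, f !![piInf Fq ^ 2, polyToK Fq (Polynomial.C c) * piInf Fq; 0, 1]

/-- The element `u = Σ_{i=1}^{d+1} c_i π_∞^i` of `K_∞` attached to a tuple of coefficients. -/
def uOf (d : ℕ) (c : Fin (d + 1) → Fq) : Kinf Fq :=
  ∑ i : Fin (d + 1), HahnSeries.single ((i : ℤ) + 1) (c i)

/-- The Fourier coefficient `c_𝔪(f)` for a monic polynomial `𝔪`. -/
def cm (𝔪 : Polynomial Fq) (f : Matrix (Fin 2) (Fin 2) (Kinf Fq) → ℂ) : ℂ :=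
  (Fintype.card Fq : ℂ)⁻¹ *
    ∑ c : Fin (𝔪.natDegree + 1) → Fq,
      f !![piInf Fq ^ (𝔪.natDegree + 2), uOf Fq 𝔪.natDegree c; 0, 1] *
        psi Fq (-(polyToK Fq 𝔪 * uOf Fq 𝔪.natDegree c))

/-- `δ_𝔫(c,d)`: the least `m` such that some `x, y` of degree at most `m`
satisfy `gcd(cx + dy, 𝔫) = 1`. -/
def deltaN (𝔫 c d : Polynomial Fq) : ℕ :=
  sInf { m : ℕ | ∃ x y : Polynomial Fq, x.degree ≤ (m : WithBot ℕ) ∧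
    y.degree ≤ (m : WithBot ℕ) ∧ IsCoprime (c * x + d * y) 𝔫 }

open Classical in
/-- `ε_𝔫(c,d) ∈ {0,1}`. -/
def epsN (𝔫 c d : Polynomial Fq) : ℕ :=
  if ∃ x₀ y₀ : Polynomial Fq, y₀.degree < x₀.degree ∧
      x₀.degree = (deltaN Fq 𝔫 c d : WithBot ℕ) ∧ IsCoprime (c * x₀ + d * y₀) 𝔫
  then 0 else 1

/-- The set `S(c,d;m)`. -/
def Sset (c d : Polynomial Fq) (m : ℕ) : Set (Polynomial Fq) :=
  { z | ∃ x y : Polynomial Fq, x.degree ≤ (m : WithBot ℕ) ∧ y.degree ≤ (m : WithBot ℕ) ∧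
      z = x * c + y * d }

/-- `t(c,d;m)`: the largest cardinality of a pairwise-coprime subset of `S(c,d;m)`. -/
def tcd (c d : Polynomial Fq) (m : ℕ) : ℕ :=
  sSup { n : ℕ | ∃ S' : Finset (Polynomial Fq), ↑S' ⊆ Sset Fq c d m ∧
    (∀ a ∈ S', ∀ b ∈ S', a ≠ b → IsCoprime a b) ∧ S'.card = n }

/-- `t(m,n) ∈ ℕ∞`. -/
def tmn (m n : ℕ) : ℕ∞ :=
  sInf { k : ℕ∞ | ∃ c d : Polynomial Fq, IsCoprime c d ∧
    ((m : WithBot ℕ) + 1) < max c.degree d.degree ∧ max c.degree d.degree < (n : WithBot ℕ) ∧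
    k = (tcd Fq c d m : ℕ∞) }

/-- `t(𝔫)`: the number of distinct monic prime factors of `𝔫`. -/
def tPrimes (𝔫 : Polynomial Fq) : ℕ :=
  Set.ncard { p : Polynomial Fq | p.Monic ∧ Irreducible p ∧ p ∣ 𝔫 }

/-- `τ(𝔫)`. -/
def tauN (𝔫 : Polynomial Fq) : ℕ :=
  sInf { m : ℕ | (tPrimes Fq 𝔫 : ℕ∞) < tmn Fq m 𝔫.natDegree }

section WeilDecomposition

variable (F : Type) [Field F]

theorem polyToK_coeff (p : Polynomial F) (n : ℕ) :
    (polyToK F p).coeff (-(n : ℤ)) = p.coeff n := by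
  induction p using Polynomial.induction_on' with
  | add p q hp hq => simp [hp, hq]
  | monomial m a =>
    have hm : polyToK F (monomial m a) = HahnSeries.single (-(m : ℤ)) a := by
      simp [polyToK, thetaK, aeval_monomial, LaurentSeries.algebraMap_apply, HahnSeries.C_apply]
    rw [hm, coeff_monomial, HahnSeries.coeff_single]
    simp [eq_comm]

theorem polyToK_ne_zero {p : Polynomial F} (hp : p ≠ 0) : polyToK F p ≠ 0 := fun h =>
  leadingCoeff_ne_zero.mpr hp (by
    rw [leadingCoeff, ← polyToK_coeff, h, HahnSeries.coeff_zero])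

theorem order_polyToK_nonpos {p : Polynomial F} (hp : p ≠ 0) : (polyToK F p).order ≤ 0 := by
  have h : (polyToK F p).coeff (-(p.natDegree : ℤ)) ≠ 0 := by
    rw [polyToK_coeff]
    exact leadingCoeff_ne_zero.mpr hp
  have := HahnSeries.order_le_of_coeff_ne_zero h
  omega

theorem order_polyToK_of_isUnit {p : Polynomial F} (hp : IsUnit p) :
    (polyToK F p).order = 0 := by
  obtain ⟨q, hpq⟩ := hp.exists_right_inv
  have hne : p * q ≠ 0 := hpq ▸ one_ne_zero
  have hp0 := left_ne_zero_of_mul hne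
  have hq0 := right_ne_zero_of_mul hne
  have h := congrArg (fun x => (polyToK F x).order) hpq
  simp only [map_mul, map_one, HahnSeries.order_one] at h
  rw [HahnSeries.order_mul (polyToK_ne_zero F hp0) (polyToK_ne_zero F hq0)] at h
  have := order_polyToK_nonpos F hp0
  have := order_polyToK_nonpos F hq0
  omega

theorem thetaK_ne_zero : thetaK F ≠ 0 := HahnSeries.single_ne_zero one_ne_zero

theorem order_thetaK_pow (r : ℕ) : (thetaK F ^ r).order = -(r : ℤ) := by
  rw [HahnSeries.order_pow, thetaK, HahnSeries.order_single one_ne_zero]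
  simp

variable {F}

theorem memO.order_nonneg {x : Kinf F} (hx : memO F x) : 0 ≤ x.order := by
  by_contra! h
  have h0 : x ≠ 0 := by
    rintro rfl
    simp at h
  exact HahnSeries.coeff_order_eq_zero.not.mpr h0 (hx _ h)

theorem memO_of_order_nonneg {x : Kinf F} (hx : 0 ≤ x.order) : memO F x := fun _ hn =>
  HahnSeries.coeff_eq_zero_of_lt_order (hn.trans_le hx)

theorem memO.add {x y : Kinf F} (hx : memO F x) (hy : memO F y) : memO F (x + y) :=
  fun n hn => by rw [HahnSeries.coeff_add, hx n hn, hy n hn, add_zero]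

theorem memO.neg {x : Kinf F} (hx : memO F x) : memO F (-x) :=
  fun n hn => by rw [HahnSeries.coeff_neg, hx n hn, neg_zero]

theorem memO.mul {x y : Kinf F} (hx : memO F x) (hy : memO F y) : memO F (x * y) := by
  by_cases hx0 : x = 0
  · simp [hx0, memO]
  by_cases hy0 : y = 0
  · simp [hy0, memO]
  apply memO_of_order_nonneg
  rw [HahnSeries.order_mul hx0 hy0]
  exact add_nonneg hx.order_nonneg hy.order_nonneg

theorem MatO.mul {κ κ' : Matrix (Fin 2) (Fin 2) (Kinf F)} (h : MatO F κ) (h' : MatO F κ') :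
    MatO F (κ * κ') := fun i j => by
  rw [mul_apply, Fin.sum_univ_two]
  exact ((h i 0).mul (h' 0 j)).add ((h i 1).mul (h' 1 j))

theorem MatO.adjugate {κ : Matrix (Fin 2) (Fin 2) (Kinf F)} (h : MatO F κ) :
    MatO F κ.adjugate := fun i j => by
  rw [adjugate_fin_two]
  fin_cases i <;> fin_cases j
  exacts [h 1 1, (h 0 1).neg, (h 1 0).neg, h 0 0]

theorem MatO.det {κ : Matrix (Fin 2) (Fin 2) (Kinf F)} (h : MatO F κ) : memO F κ.det := by
  rw [det_fin_two, sub_eq_add_neg]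
  exact ((h 0 0).mul (h 1 1)).add ((h 0 1).mul (h 1 0)).neg

theorem InGLO.det_ne_zero {κ : Matrix (Fin 2) (Fin 2) (Kinf F)} (h : InGLO F κ) :
    κ.det ≠ 0 := fun h0 => h.2 (by rw [h0, HahnSeries.coeff_zero])

theorem InGLO.order_det {κ : Matrix (Fin 2) (Fin 2) (Kinf F)} (h : InGLO F κ) :
    κ.det.order = 0 :=
  (HahnSeries.order_le_of_coeff_ne_zero h.2).antisymm h.1.det.order_nonneg

/-- A nonzero polynomial has nonpositive order, so it cannot take an element to one of larger
order. -/
theorem eq_zero_of_polyToK_mul_eq {p : Polynomial F} {x y k : Kinf F} (hx : x ≠ 0)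
    (hk : memO F k) (hxy : x.order < y.order) (h : polyToK F p * x = y * k) : p = 0 := by
  by_contra hp
  have hp' := polyToK_ne_zero F hp
  have hyk : y * k ≠ 0 := h ▸ mul_ne_zero hp' hx
  have ho := congrArg HahnSeries.order h
  rw [HahnSeries.order_mul hp' hx,
    HahnSeries.order_mul (left_ne_zero_of_mul hyk) (right_ne_zero_of_mul hyk)] at ho
  have := order_polyToK_nonpos F hp
  have := hk.order_nonneg
  omega

theorem det_weil_product (r : ℕ) (γ : Matrix (Fin 2) (Fin 2) (Polynomial F)) (z : Kinf F)
    (κ : Matrix (Fin 2) (Fin 2) (Kinf F)) :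
    (γ.map (polyToK F) * Dmat F r * (z • (1 : Matrix (Fin 2) (Fin 2) (Kinf F))) * κ).det =
      polyToK F γ.det * thetaK F ^ r * (z * z) * κ.det := by
  have hγ : (γ.map (polyToK F)).det = polyToK F γ.det := ((polyToK F).map_det γ).symm
  simp [det_mul, hγ, Dmat, det_fin_two_of, pow_two]
  ring

theorem order_det_weil_product (r : ℕ) {γ : Matrix (Fin 2) (Fin 2) (Polynomial F)}
    (hγ : IsUnit γ.det) {z : Kinf F} (hz : z ≠ 0)
    {κ : Matrix (Fin 2) (Fin 2) (Kinf F)} (hκ : InGLO F κ) :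
    (γ.map (polyToK F) * Dmat F r *
      (z • (1 : Matrix (Fin 2) (Fin 2) (Kinf F))) * κ).det.order = 2 * z.order - r := by
  have h1 := polyToK_ne_zero F hγ.ne_zero
  have h2 := pow_ne_zero r (thetaK_ne_zero F)
  have h3 := mul_ne_zero hz hz
  rw [det_weil_product, HahnSeries.order_mul (mul_ne_zero (mul_ne_zero h1 h2) h3) hκ.det_ne_zero,
    HahnSeries.order_mul (mul_ne_zero h1 h2) h3, HahnSeries.order_mul h1 h2,
    HahnSeries.order_mul hz hz, order_polyToK_of_isUnit F hγ, order_thetaK_pow, hκ.order_det]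
  ring

theorem le_of_weil_product_eq {r r' : ℕ} {γ γ' : Matrix (Fin 2) (Fin 2) (Polynomial F)}
    (hγ : IsUnit γ.det) (hγ' : IsUnit γ'.det) {z z' : Kinf F} (hz : z ≠ 0) (hz' : z' ≠ 0)
    {κ κ' : Matrix (Fin 2) (Fin 2) (Kinf F)} (hκ : InGLO F κ) (hκ' : InGLO F κ')
    (h : γ.map (polyToK F) * Dmat F r *
          (z • (1 : Matrix (Fin 2) (Fin 2) (Kinf F))) * κ =
        γ'.map (polyToK F) * Dmat F r' *
          (z' • (1 : Matrix (Fin 2) (Fin 2) (Kinf F))) * κ') :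
    r' ≤ r := by
  by_contra! hr
  have hdet := congrArg (fun M => M.det.order) h
  simp only [order_det_weil_product _ hγ hz hκ, order_det_weil_product _ hγ' hz' hκ'] at hdet
  have hzz : z.order < z'.order := by omega
  set g := γ'.adjugate * γ with hg
  set k := κ' * κ.adjugate with hk
  have hkO : MatO F k := hκ'.1.mul hκ.1.adjugate
  have hadj : γ'.adjugate.map (polyToK F) * γ'.map (polyToK F) =
      polyToK F γ'.det • (1 : Matrix (Fin 2) (Fin 2) (Kinf F)) := by
    rw [← Matrix.map_mul, adjugate_mul]
    ext i j
    simp [one_apply, apply_ite (polyToK F)]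
  have key : (z * κ.det) • (g.map (polyToK F) * Dmat F r) =
      (z' * polyToK F γ'.det) • (Dmat F r' * k) := by
    have h' := congrArg (fun M => γ'.adjugate.map (polyToK F) * M * κ.adjugate) h
    simp only [Matrix.mul_smul, Matrix.smul_mul, Matrix.mul_one] at h'
    calc _ = γ'.adjugate.map (polyToK F) * (z • (γ.map (polyToK F) * Dmat F r) * κ) *
          κ.adjugate := by
          rw [hg, Matrix.map_mul, ← Matrix.mul_assoc, Matrix.mul_assoc _ κ, mul_adjugate]
          simp [Matrix.mul_assoc, smul_smul, mul_comm]
      _ = _ := by simpa using h'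
      _ = _ := by
          simp only [Matrix.smul_mul, ← Matrix.mul_assoc, hadj]
          simp [Matrix.mul_assoc, smul_smul, hk]
  have hκ0 := hκ.det_ne_zero
  have hd0 := polyToK_ne_zero F hγ'.ne_zero
  have hθ := pow_ne_zero r (thetaK_ne_zero F)
  have hzκ := mul_ne_zero hz hκ0
  have ho : (z' * polyToK F γ'.det).order = z'.order := by
    rw [HahnSeries.order_mul hz' hd0, order_polyToK_of_isUnit F hγ', add_zero]
  have ho' : (z * κ.det).order = z.order := by
    rw [HahnSeries.order_mul hz hκ0, hκ.order_det, add_zero]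
  have h10 : g 1 0 = 0 := by
    refine eq_zero_of_polyToK_mul_eq (x := z * κ.det * thetaK F ^ r)
      (y := z' * polyToK F γ'.det) (mul_ne_zero hzκ hθ) (hkO 1 0) ?_ ?_
    · rw [HahnSeries.order_mul hzκ hθ, ho, ho', order_thetaK_pow]
      omega
    · have := congrFun (congrFun key 1) 0
      simp only [Matrix.smul_apply, mul_apply, Fin.sum_univ_two, Dmat, map_apply,
        smul_eq_mul] at this
      simp at this
      linear_combination this
  have h11 : g 1 1 = 0 := by
    refine eq_zero_of_polyToK_mul_eq (x := z * κ.det)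
      (y := z' * polyToK F γ'.det) hzκ (hkO 1 1) (by rwa [ho, ho']) ?_
    have := congrFun (congrFun key 1) 1
    simp only [Matrix.smul_apply, mul_apply, Fin.sum_univ_two, Dmat, map_apply,
      smul_eq_mul] at this
    simp at this
    linear_combination this
  have hgdet : g.det = 0 := by rw [det_fin_two, h10, h11]; ring
  rw [hg, det_mul, det_adjugate] at hgdet
  exact mul_ne_zero (pow_ne_zero _ hγ'.ne_zero) hγ.ne_zero hgdet

end WeilDecomposition

/-- **Weil decomposition, uniqueness of the exponent `r`.** -/
theorem weil_decomposition_uniqueness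
    (Fq : Type) [Field Fq] [Fintype Fq]
    (r r' : ℕ) (γ γ' : Matrix (Fin 2) (Fin 2) (Polynomial Fq))
    (hγ : IsUnit γ.det) (hγ' : IsUnit γ'.det)
    (z z' : Kinf Fq) (hz : z ≠ 0) (hz' : z' ≠ 0)
    (κ κ' : Matrix (Fin 2) (Fin 2) (Kinf Fq)) (hκ : InGLO Fq κ) (hκ' : InGLO Fq κ')
    (h : γ.map (polyToK Fq) * Dmat Fq r *
          (z • (1 : Matrix (Fin 2) (Fin 2) (Kinf Fq))) * κ =
        γ'.map (polyToK Fq) * Dmat Fq r' *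
          (z' • (1 : Matrix (Fin 2) (Fin 2) (Kinf Fq))) * κ') :
    r = r' := by
  exact (le_of_weil_product_eq hγ' hγ hz' hz hκ' hκ h.symm).antisymm
    (le_of_weil_product_eq hγ hγ' hz hz' hκ hκ' h)
end SturmFF
end
end

section
/- Standard form of the edge γ·e₀ (part 1): Let γ = (a, b; c, d) ∈ GL₂(A). (Case 1) If deg c < deg d, then there exist u ∈ K_∞, z ∈ K_∞^×, and κ ∈ I_∞ such that γ = (π_∞^{2·deg d}, u; 0, 1) · z · κ. (Case 2) If deg c ≥ deg d, then there exist u ∈ K_∞, z ∈ K_∞^×, and κ ∈ I_∞ such that γ = (π_∞^{2·deg c + 1}, u; 0, 1) · (0, 1; π_∞, 0) · z · κ. -/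
open Polynomial Matrix

noncomputable section

namespace SturmFF

variable (Fq : Type) [Field Fq] [Fintype Fq]

theorem piInf_ne_zero (Fq : Type) [Field Fq] : piInf Fq ≠ 0 := by
  simp [piInf]

theorem piInf_mul_thetaK (Fq : Type) [Field Fq] : piInf Fq * thetaK Fq = 1 := by
  simp [piInf, thetaK]

theorem polyToK_C (Fq : Type) [Field Fq] (e : Fq) :
    polyToK Fq (Polynomial.C e) = HahnSeries.ofPowerSeries ℤ Fq (PowerSeries.C e) := by
  simp only [polyToK, AlgHom.toRingHom_eq_coe, RingHom.coe_coe, Polynomial.aeval_C,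
    HahnSeries.algebraMap_apply', PowerSeries.algebraMap_apply, Algebra.algebraMap_self_apply]

theorem polyToK_X (Fq : Type) [Field Fq] : polyToK Fq Polynomial.X = thetaK Fq := by
  simp [polyToK]

theorem memO_ofPowerSeries (Fq : Type) [Field Fq] (f : PowerSeries Fq) :
    memO Fq (HahnSeries.ofPowerSeries ℤ Fq f) := by
  intro n hn
  rw [PowerSeries.coeff_coe, if_pos hn]

theorem coeff_zero_ofPowerSeries (Fq : Type) [Field Fq] (f : PowerSeries Fq) :
    (HahnSeries.ofPowerSeries ℤ Fq f).coeff 0 = PowerSeries.constantCoeff f := by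
  rw [PowerSeries.coeff_coe]
  simp

/-- A polynomial of degree at most `n` becomes integral after multiplication by `π_∞ ^ n`, and
its residue is the coefficient of degree `n`. -/
theorem exists_ofPowerSeries_eq_piInf_pow_mul (Fq : Type) [Field Fq] (p : Polynomial Fq) (n : ℕ)
    (hp : p.natDegree ≤ n) :
    ∃ f : PowerSeries Fq, HahnSeries.ofPowerSeries ℤ Fq f = piInf Fq ^ n * polyToK Fq p ∧
      PowerSeries.constantCoeff f = p.coeff n := by
  refine ⟨∑ i ∈ Finset.range (n + 1), PowerSeries.C (p.coeff i) * PowerSeries.X ^ (n - i), ?_, ?_⟩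
  · conv_rhs => rw [p.as_sum_range_C_mul_X_pow' (Nat.lt_succ_of_le hp)]
    rw [map_sum, map_sum, Finset.mul_sum]
    refine Finset.sum_congr rfl fun i hi => ?_
    have hi' : n = n - i + i := by have := Finset.mem_range.mp hi; omega
    have hX : HahnSeries.ofPowerSeries ℤ Fq PowerSeries.X = piInf Fq :=
      HahnSeries.ofPowerSeries_X
    have hpow : piInf Fq ^ i * thetaK Fq ^ i = 1 := by
      rw [← mul_pow, piInf_mul_thetaK, one_pow]
    have hn : piInf Fq ^ n = piInf Fq ^ (n - i) * piInf Fq ^ i := by rw [← pow_add, ← hi']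
    rw [map_mul, map_mul, map_pow, map_pow, hX, polyToK_C, polyToK_X, hn]
    linear_combination (-HahnSeries.ofPowerSeries ℤ Fq (PowerSeries.C (p.coeff i)) *
      piInf Fq ^ (n - i)) * hpow
  · rw [map_sum, Finset.sum_range_succ, Finset.sum_eq_zero]
    · simp
    · intro i hi
      have : n - i ≠ 0 := by have := Finset.mem_range.mp hi; omega
      simp [this]

/-- A matrix over `𝔽_q[[π_∞]]` whose lower left entry has zero residue
and whose diagonal entries are units lies in the Iwahori subgroup. -/
theorem inIw_of_ofPowerSeries (Fq : Type) [Field Fq] (f g h k : PowerSeries Fq)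
    (hf : PowerSeries.constantCoeff f ≠ 0) (hk : PowerSeries.constantCoeff k ≠ 0)
    (hh : PowerSeries.constantCoeff h = 0) :
    InIw Fq !![HahnSeries.ofPowerSeries ℤ Fq f, HahnSeries.ofPowerSeries ℤ Fq g;
      HahnSeries.ofPowerSeries ℤ Fq h, HahnSeries.ofPowerSeries ℤ Fq k] := by
  refine ⟨⟨?_, ?_⟩, ?_⟩
  · intro i j
    fin_cases i <;> fin_cases j <;> exact memO_ofPowerSeries Fq _
  · rw [Matrix.det_fin_two_of, ← map_mul, ← map_mul, ← map_sub, coeff_zero_ofPowerSeries]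
    simp [hf, hk, hh]
  · intro n hn
    change (HahnSeries.ofPowerSeries ℤ Fq h).coeff n = 0
    rcases (Int.lt_add_one_iff.mp hn : n ≤ 0).lt_or_eq with hn | rfl
    · exact memO_ofPowerSeries Fq h n hn
    · rw [coeff_zero_ofPowerSeries, hh]

/-- **Standard form of the edge `γ·e₀` (part 1).** -/
theorem standard_form_edge_part1
    (Fq : Type) [Field Fq] [Fintype Fq]
    (γ : Matrix (Fin 2) (Fin 2) (Polynomial Fq)) (hγ : IsUnit γ.det) :
    ((γ 1 0).degree < (γ 1 1).degree →
      ∃ (u z : Kinf Fq) (κ : Matrix (Fin 2) (Fin 2) (Kinf Fq)), z ≠ 0 ∧ InIw Fq κ ∧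
        γ.map (polyToK Fq) =
          !![piInf Fq ^ (2 * (γ 1 1).natDegree), u; 0, 1] *
            (z • (1 : Matrix (Fin 2) (Fin 2) (Kinf Fq))) * κ)
    ∧ ((γ 1 1).degree ≤ (γ 1 0).degree →
      ∃ (u z : Kinf Fq) (κ : Matrix (Fin 2) (Fin 2) (Kinf Fq)), z ≠ 0 ∧ InIw Fq κ ∧
        γ.map (polyToK Fq) =
          !![piInf Fq ^ (2 * (γ 1 0).natDegree + 1), u; 0, 1] * Jmat Fq *
            (z • (1 : Matrix (Fin 2) (Fin 2) (Kinf Fq))) * κ) := by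
  obtain ⟨e, he, hdet⟩ := Polynomial.isUnit_iff.mp hγ
  have he : e ≠ 0 := he.ne_zero
  have hE : polyToK Fq (γ 0 0) * polyToK Fq (γ 1 1) - polyToK Fq (γ 0 1) * polyToK Fq (γ 1 0) =
      HahnSeries.ofPowerSeries ℤ Fq (PowerSeries.C e) := by
    rw [← polyToK_C, hdet, Matrix.det_fin_two, map_sub, map_mul, map_mul]
  have ht := piInf_ne_zero Fq
  constructor
  · intro hdeg
    have hd : γ 1 1 ≠ 0 := Polynomial.ne_zero_of_degree_gt hdeg
    set n := (γ 1 1).natDegree with hn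
    have hT : piInf Fq ^ n ≠ 0 := pow_ne_zero _ ht
    obtain ⟨f, hf, hf0⟩ := exists_ofPowerSeries_eq_piInf_pow_mul Fq (γ 1 1) n le_rfl
    obtain ⟨h, hh, hh0⟩ := exists_ofPowerSeries_eq_piInf_pow_mul Fq (γ 1 0) n
      (Polynomial.natDegree_le_natDegree hdeg.le)
    have hf1 : PowerSeries.constantCoeff f ≠ 0 := by
      rw [hf0]
      exact Polynomial.leadingCoeff_ne_zero.mpr hd
    have hh1 : PowerSeries.constantCoeff h = 0 := by
      rw [hh0]
      exact Polynomial.coeff_eq_zero_of_degree_lt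
        (hdeg.trans_eq (Polynomial.degree_eq_natDegree hd))
    have hfinv := congrArg (HahnSeries.ofPowerSeries ℤ Fq) (PowerSeries.mul_inv_cancel f hf1)
    rw [map_mul, map_one, hf] at hfinv
    have hdK : polyToK Fq (γ 1 1) ≠ 0 :=
      right_ne_zero_of_mul (left_ne_zero_of_mul_eq_one hfinv)
    refine ⟨polyToK Fq (γ 0 1) / polyToK Fq (γ 1 1), (piInf Fq ^ n)⁻¹, _, inv_ne_zero hT,
      inIw_of_ofPowerSeries Fq (PowerSeries.C e * f⁻¹) 0 h f (by simp [he, hf1]) hf1 hh1, ?_⟩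
    rw [map_mul, ← hE, hf, hh, eq_inv_of_mul_eq_one_right hfinv, pow_mul', map_zero]
    ext i j : 1
    fin_cases i <;> fin_cases j <;>
      simp [Matrix.mul_apply, Fin.sum_univ_two] <;> field_simp
    ring
  · intro hdeg
    have hc : γ 1 0 ≠ 0 := by
      intro hc
      have hd : γ 1 1 = 0 := by simpa [hc] using hdeg
      rw [Matrix.det_fin_two, hc, hd] at hγ
      simp at hγ
    set n := (γ 1 0).natDegree with hn
    have hT : piInf Fq ^ n ≠ 0 := pow_ne_zero _ ht
    obtain ⟨f, hf, hf0⟩ := exists_ofPowerSeries_eq_piInf_pow_mul Fq (γ 1 0) n le_rfl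
    obtain ⟨h, hh, -⟩ := exists_ofPowerSeries_eq_piInf_pow_mul Fq (γ 1 1) n
      (Polynomial.natDegree_le_natDegree hdeg)
    have hf1 : PowerSeries.constantCoeff f ≠ 0 := by
      rw [hf0]
      exact Polynomial.leadingCoeff_ne_zero.mpr hc
    have hfinv := congrArg (HahnSeries.ofPowerSeries ℤ Fq) (PowerSeries.mul_inv_cancel f hf1)
    rw [map_mul, map_one, hf] at hfinv
    have hcK : polyToK Fq (γ 1 0) ≠ 0 :=
      right_ne_zero_of_mul (left_ne_zero_of_mul_eq_one hfinv)
    refine ⟨polyToK Fq (γ 0 0) / polyToK Fq (γ 1 0), (piInf Fq ^ n * piInf Fq)⁻¹, _,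
      inv_ne_zero (mul_ne_zero hT ht),
      inIw_of_ofPowerSeries Fq f h 0 (-(PowerSeries.C e * f⁻¹)) hf1 (by simp [he, hf1])
        (map_zero _), ?_⟩
    rw [map_neg, map_mul, ← hE, hf, hh, eq_inv_of_mul_eq_one_right hfinv, pow_succ, pow_mul',
      map_zero, Jmat]
    ext i j : 1
    fin_cases i <;> fin_cases j <;>
      simp [Matrix.mul_apply, Fin.sum_univ_two] <;> field_simp
    ring
end SturmFF
end
end
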